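/- Let i ≠ j be indices with M i j = 0 (an ∞-edge). Let v = Σ_{s=1}^n c_s α_s with all coefficients c_s ≥ 0, and suppose σ_i(v) = v and σ_j(v) = v. Then c_i = c_j, and c_s = 0 for every s ∉ {i, j} such that M s i ≠ 2 or M s j ≠ 2. In particular, v belongs to the linear span of the vector α_i + α_j together with the vectors α_k for which M k i = 2 and M k j = 2. -/

import Mathlib

open scoped BigOperators

/-- The simple root `α_i`, the `i`-th standard basis vector of `ℝ^n`. -/
noncomputable def simpleRoot {n : ℕ} (i : Fin n) : Fin n → ℝ := Pi.single i 1

/-- The symmetric bilinear form `B` associated to the Coxeter matrix `M`, determined by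
`B(α_i, α_j) = -cos (π / M i j)` when `M i j ≠ 0` and `B(α_i, α_j) = -1` when
`M i j = 0` (the label `∞`). -/
noncomputable def bform {n : ℕ} (M : CoxeterMatrix (Fin n)) (u v : Fin n → ℝ) : ℝ :=
  ∑ i, ∑ j, u i * (if M i j = 0 then -1 else -Real.cos (Real.pi / (M i j))) * v j

/-- The simple reflection `σ_i(v) = v - 2 B(v, α_i) α_i`. -/
noncomputable def simpleRefl {n : ℕ} (M : CoxeterMatrix (Fin n)) (i : Fin n)
    (v : Fin n → ℝ) : Fin n → ℝ :=
  v - (2 * bform M v (simpleRoot i)) • simpleRoot i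

/-- The set `Σ` of small roots of `M`: the smallest set of vectors containing the simple
roots `α_1, …, α_n` and such that whenever `v ∈ Σ` and `-1 < B(v, α_i) < 0`, also
`σ_i(v) ∈ Σ`. -/
inductive IsSmallRoot {n : ℕ} (M : CoxeterMatrix (Fin n)) : (Fin n → ℝ) → Prop
  | simple (i : Fin n) : IsSmallRoot M (simpleRoot i)
  | reflect {v : Fin n → ℝ} (i : Fin n) : IsSmallRoot M v →
      -1 < bform M v (simpleRoot i) → bform M v (simpleRoot i) < 0 →
      IsSmallRoot M (simpleRefl M i v)

/-- The entry `B(α_s, α_t)` of the Gram matrix of the form `B`. -/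
noncomputable def gramEntry {n : ℕ} (M : CoxeterMatrix (Fin n)) (s t : Fin n) : ℝ :=
  if M s t = 0 then -1 else -Real.cos (Real.pi / (M s t))

lemma gramEntry_self {n : ℕ} (M : CoxeterMatrix (Fin n)) (s : Fin n) :
    gramEntry M s s = 1 := by
  simp [gramEntry]

lemma gramEntry_of_eq_zero {n : ℕ} (M : CoxeterMatrix (Fin n)) {s t : Fin n}
    (h : M s t = 0) : gramEntry M s t = -1 := by
  simp [gramEntry, h]

lemma gramEntry_of_eq_two {n : ℕ} (M : CoxeterMatrix (Fin n)) {s t : Fin n}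
    (h : M s t = 2) : gramEntry M s t = 0 := by
  simp [gramEntry, h]

lemma gramEntry_neg {n : ℕ} (M : CoxeterMatrix (Fin n)) {s t : Fin n} (hst : s ≠ t)
    (h : M s t ≠ 2) : gramEntry M s t < 0 := by
  unfold gramEntry
  split_ifs with h0
  · norm_num
  · have h1 : M s t ≠ 1 := M.off_diagonal s t hst
    have h3 : (3 : ℝ) ≤ M s t := by
      have : 3 ≤ M s t := by omega
      exact_mod_cast this
    have hpos : 0 < Real.pi / (M s t) := by positivity
    have hlt : Real.pi / (M s t) < Real.pi / 2 :=
      div_lt_div_of_pos_left Real.pi_pos two_pos (by linarith)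
    exact neg_neg_of_pos (Real.cos_pos_of_mem_Ioo ⟨by linarith, hlt⟩)

lemma gramEntry_nonpos {n : ℕ} (M : CoxeterMatrix (Fin n)) {s t : Fin n} (hst : s ≠ t) :
    gramEntry M s t ≤ 0 := by
  by_cases h : M s t = 2
  · exact (gramEntry_of_eq_two M h).le
  · exact (gramEntry_neg M hst h).le

lemma bform_simpleRoot {n : ℕ} (M : CoxeterMatrix (Fin n)) (v : Fin n → ℝ) (i : Fin n) :
    bform M v (simpleRoot i) = ∑ s, v s * gramEntry M s i := by
  simp [bform, simpleRoot, gramEntry, Pi.single_apply]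

lemma bform_simpleRoot_eq_zero_of_simpleRefl_eq {n : ℕ} (M : CoxeterMatrix (Fin n))
    {v : Fin n → ℝ} {i : Fin n} (h : simpleRefl M i v = v) :
    bform M v (simpleRoot i) = 0 := by
  simpa [simpleRefl, simpleRoot] using congrFun h i

lemma sum_smul_simpleRoot {n : ℕ} (c : Fin n → ℝ) : ∑ s, c s • simpleRoot s = c := by
  ext t
  simp [simpleRoot, Finset.sum_apply, Pi.single_apply]

/-- **Stabiliser lemma.** Let `i ≠ j` with `M i j = 0` (an `∞`-edge), and let
`v = ∑ c_s α_s` with all `c_s ≥ 0` be fixed by both `σ_i` and `σ_j`. Then `c_i = c_j`, and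
`c_s = 0` for every `s ∉ {i, j}` with `M s i ≠ 2` or `M s j ≠ 2`. In particular `v` lies in
the span of `α_i + α_j` together with the `α_k` with `M k i = 2` and `M k j = 2`. -/
theorem stabiliser_lemma {n : ℕ} (hn : 3 ≤ n) (M : CoxeterMatrix (Fin n))
    (i j : Fin n) (hij : i ≠ j) (hMij : M i j = 0)
    (c : Fin n → ℝ) (hc : ∀ s, 0 ≤ c s) (v : Fin n → ℝ)
    (hv : v = ∑ s, c s • simpleRoot s)
    (hfi : simpleRefl M i v = v) (hfj : simpleRefl M j v = v) :
    c i = c j ∧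
    (∀ s, s ≠ i → s ≠ j → (M s i ≠ 2 ∨ M s j ≠ 2) → c s = 0) ∧
    v ∈ Submodule.span ℝ
      ({simpleRoot i + simpleRoot j} ∪
        {u | ∃ k : Fin n, M k i = 2 ∧ M k j = 2 ∧ u = simpleRoot k}) := by
  have hvc : v = c := hv.trans (sum_smul_simpleRoot c)
  have hMji : M j i = 0 := (M.symmetric j i).trans hMij
  have hi := bform_simpleRoot_eq_zero_of_simpleRefl_eq M hfi
  have hj := bform_simpleRoot_eq_zero_of_simpleRefl_eq M hfj
  rw [bform_simpleRoot, hvc] at hi hj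
  have hterm : ∀ s, c s * (gramEntry M s i + gramEntry M s j) ≤ 0 := by
    intro s
    by_cases hsi : s = i
    · simp [hsi, gramEntry_self, gramEntry_of_eq_zero M hMij]
    by_cases hsj : s = j
    · simp [hsj, gramEntry_self, gramEntry_of_eq_zero M hMji]
    exact mul_nonpos_of_nonneg_of_nonpos (hc s)
      (add_nonpos (gramEntry_nonpos M hsi) (gramEntry_nonpos M hsj))
  have hsum : ∑ s, c s * (gramEntry M s i + gramEntry M s j) = 0 := by
    simp only [mul_add, Finset.sum_add_distrib, hi, hj, add_zero]
  have hzero : ∀ s, c s * (gramEntry M s i + gramEntry M s j) = 0 := fun s =>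
    (Finset.sum_eq_zero_iff_of_nonpos fun s _ => hterm s).1 hsum s (Finset.mem_univ s)
  have hvanish : ∀ s, s ≠ i → s ≠ j → (M s i ≠ 2 ∨ M s j ≠ 2) → c s = 0 := by
    intro s hsi hsj h
    refine (mul_eq_zero.1 (hzero s)).resolve_right (ne_of_lt ?_)
    rcases h with h | h
    · exact add_neg_of_neg_of_nonpos (gramEntry_neg M hsi h) (gramEntry_nonpos M hsj)
    · exact add_neg_of_nonpos_of_neg (gramEntry_nonpos M hsi) (gramEntry_neg M hsj h)
  have hcij : c i = c j := by
    rw [Fintype.sum_eq_add i j hij, gramEntry_self, gramEntry_of_eq_zero M hMji] at hi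
    · linarith
    · rintro s ⟨hsi, hsj⟩
      by_cases h : M s i = 2
      · rw [gramEntry_of_eq_two M h, mul_zero]
      · rw [hvanish s hsi hsj (Or.inl h), zero_mul]
  refine ⟨hcij, hvanish, ?_⟩
  have hdecomp : v = c i • (simpleRoot i + simpleRoot j) +
      ∑ s ∈ Finset.univ \ {i, j}, c s • simpleRoot s := by
    rw [hv, ← Finset.sum_sdiff (Finset.subset_univ {i, j}), Finset.sum_pair hij, smul_add,
      hcij, add_comm]
  rw [hdecomp]
  refine Submodule.add_mem _ (Submodule.smul_mem _ _ (Submodule.subset_span (Or.inl rfl)))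
    (Submodule.sum_mem _ fun s hs => ?_)
  simp only [Finset.mem_sdiff, Finset.mem_univ, true_and, Finset.mem_insert,
    Finset.mem_singleton, not_or] at hs
  by_cases h : M s i = 2 ∧ M s j = 2
  · exact Submodule.smul_mem _ _ (Submodule.subset_span (Or.inr ⟨s, h.1, h.2, rfl⟩))
  · rw [hvanish s hs.1 hs.2 (not_and_or.1 h), zero_smul]
    exact Submodule.zero_mem _
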